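/- Let B be an atomless Boolean contact algebra satisfying (DV7). Then every G-representative of B is a W-representative. -/

import Mathlib

variable {B : Type*} [BooleanAlgebra B]

/-- A Boolean contact algebra structure on a Boolean algebra `B`. -/
structure BCA (B : Type*) [BooleanAlgebra B] where
  C : B → B → Prop
  c0 : ∀ x : B, ¬ C ⊥ x
  c1 : ∀ x y : B, x ≠ ⊥ → x ≤ y → C x y
  c2 : ∀ x y : B, C x y → C y x
  c3 : ∀ x y z : B, x ≤ y → C z x → C z y
  c4 : ∀ x y z : B, C x (y ⊔ z) → C x y ∨ C x z

namespace BCA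

/-- The well-inside relation: `x ≪ y` iff `¬ (x C yᶜ)`. -/
def wi (A : BCA B) (x y : B) : Prop := ¬ A.C x yᶜ

/-- `Q₁` covers `Q₂` iff every element of `Q₁` contains some element of `Q₂`. -/
def Covers (Q₁ Q₂ : Set B) : Prop := ∀ x ∈ Q₁, ∃ y ∈ Q₂, y ≤ x

/-- A Grzegorczyk representative of a point. -/
def IsGRep (A : BCA B) (Q : Set B) : Prop :=
  Q.Nonempty ∧ (⊥ : B) ∉ Q ∧
    (∀ u ∈ Q, ∀ v ∈ Q, u = v ∨ A.wi u v ∨ A.wi v u) ∧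
    (∀ u ∈ Q, ∃ v ∈ Q, A.wi v u) ∧
    (∀ x y : B, (∀ u ∈ Q, u ⊓ x ≠ ⊥ ∧ u ⊓ y ≠ ⊥) → A.C x y)

/-- An abstractive set. -/
def IsAbstractive (A : BCA B) (S : Set B) : Prop :=
  S.Nonempty ∧ (⊥ : B) ∉ S ∧
    (∀ u ∈ S, ∀ v ∈ S, u = v ∨ A.wi u v ∨ A.wi v u) ∧
    ¬ ∃ x ∈ S, ∀ y ∈ S, x ≤ y

/-- A Whitehead representative of a point. -/
def IsWRep (A : BCA B) (S : Set B) : Prop :=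
  A.IsAbstractive S ∧ ∀ T : Set B, A.IsAbstractive T → Covers S T → Covers T S

/-- An ω-abstractive set: an abstractive set mutually covering with a countable abstractive set. -/
def IsOmegaAbstractive (A : BCA B) (S : Set B) : Prop :=
  A.IsAbstractive S ∧
    ∃ T : Set B, T.Countable ∧ A.IsAbstractive T ∧ Covers S T ∧ Covers T S

/-- A filter of the Boolean algebra `B`. -/
def IsFilter (F : Set B) : Prop :=
  F.Nonempty ∧ (⊥ : B) ∉ F ∧
    (∀ x ∈ F, ∀ y : B, x ≤ y → y ∈ F) ∧
    (∀ x ∈ F, ∀ y ∈ F, x ⊓ y ∈ F)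

/-- A round filter. -/
def IsRoundFilter (A : BCA B) (F : Set B) : Prop :=
  IsFilter F ∧ ∀ x ∈ F, ∃ y ∈ F, A.wi y x

/-- A Grzegorczyk point: the filter generated by a G-representative. -/
def IsGPoint (A : BCA B) (G : Set B) : Prop :=
  ∃ Q : Set B, A.IsGRep Q ∧ G = {y : B | ∃ x ∈ Q, x ≤ y}

/-- Atomlessness of the Boolean algebra. -/
def Atomless (B : Type*) [BooleanAlgebra B] : Prop :=
  ∀ x : B, x ≠ ⊥ → ∃ y : B, y ≠ ⊥ ∧ y < x

/-- The interpolation axiom (DV6). -/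
def DV6 (A : BCA B) : Prop := ∀ x y : B, A.wi x y → ∃ z : B, A.wi x z ∧ A.wi z y

/-- The non-tangential part axiom (DV7). -/
def DV7 (A : BCA B) : Prop := ∀ x : B, x ≠ ⊥ → ∃ y : B, y ≠ ⊥ ∧ A.wi y x

/-- The connectedness axiom (C5). -/
def C5 (A : BCA B) : Prop := ∀ x : B, x ≠ ⊥ → x ≠ ⊤ → A.C x xᶜ

/-- The countable chain condition for a Boolean algebra. -/
def CCC (B : Type*) [BooleanAlgebra B] : Prop :=
  ∀ S : Set B, (∀ x ∈ S, x ≠ ⊥) → (S.Pairwise fun x y => x ⊓ y = ⊥) → S.Countable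

end BCA

namespace BCA

theorem C_of_inf_ne_bot (A : BCA B) {x y : B} (h : x ⊓ y ≠ ⊥) : A.C x y :=
  A.c2 _ _ (A.c3 (x ⊓ y) x y inf_le_left (A.c2 _ _ (A.c1 _ _ h inf_le_right)))

theorem wi.le {A : BCA B} {x y : B} (h : A.wi x y) : x ≤ y := by
  by_contra hxy
  exact h (A.C_of_inf_ne_bot fun h0 => hxy (sdiff_eq_bot_iff.mp (sdiff_eq.trans h0)))

/-- A G-representative has no least element. -/
theorem IsGRep.not_exists_least {A : BCA B} {Q : Set B} (hat : Atomless B) (hdv7 : A.DV7)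
    (hQ : A.IsGRep Q) : ¬ ∃ x ∈ Q, ∀ y ∈ Q, x ≤ y := by
  obtain ⟨-, hbot, -, -, hC⟩ := hQ
  rintro ⟨x, hxQ, hx⟩
  obtain ⟨y, hy0, hyx⟩ := hat x (ne_of_mem_of_not_mem hxQ hbot)
  obtain ⟨z, hz0, hzy⟩ := hdv7 y hy0
  refine hzy (hC z yᶜ fun u hu => ⟨?_, fun h0 => ?_⟩)
  · rwa [inf_eq_right.mpr (hzy.le.trans (hyx.le.trans (hx u hu)))]
  · have huy : u ≤ y := sdiff_eq_bot_iff.mp (sdiff_eq.trans h0)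
    exact hyx.not_ge ((hx u hu).trans huy)

theorem IsGRep.isAbstractive {A : BCA B} {Q : Set B} (hat : Atomless B) (hdv7 : A.DV7)
    (hQ : A.IsGRep Q) : A.IsAbstractive Q :=
  ⟨hQ.1, hQ.2.1, hQ.2.2.1, hQ.not_exists_least hat hdv7⟩

theorem IsAbstractive.inf_ne_bot {A : BCA B} {T : Set B} (hT : A.IsAbstractive T) {s t : B}
    (hs : s ∈ T) (ht : t ∈ T) : s ⊓ t ≠ ⊥ := by
  have hs0 : s ≠ ⊥ := ne_of_mem_of_not_mem hs hT.2.1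
  have ht0 : t ≠ ⊥ := ne_of_mem_of_not_mem ht hT.2.1
  rcases hT.2.2.1 s hs t ht with rfl | h | h
  · rwa [inf_idem]
  · rwa [inf_eq_left.mpr h.le]
  · rwa [inf_eq_right.mpr h.le]

theorem IsAbstractive.exists_wi {A : BCA B} {T : Set B} (hT : A.IsAbstractive T) {t : B}
    (ht : t ∈ T) : ∃ s ∈ T, A.wi s t := by
  by_contra! h
  refine hT.2.2.2 ⟨t, ht, fun s hs => ?_⟩
  rcases hT.2.2.1 s hs t ht with rfl | hst | hts
  · exact le_rfl
  · exact (h s hs hst).elim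
  · exact hts.le

theorem IsGRep.covers_of_covers {A : BCA B} {Q T : Set B} (hQ : A.IsGRep Q)
    (hT : A.IsAbstractive T) (hQT : Covers Q T) : Covers T Q := by
  intro t ht
  by_contra! h
  obtain ⟨s, hs, hst⟩ := hT.exists_wi ht
  refine hst (hQ.2.2.2.2 s tᶜ fun u hu => ⟨?_, fun h0 => ?_⟩)
  · obtain ⟨r, hr, hru⟩ := hQT u hu
    exact ne_bot_of_le_ne_bot (hT.inf_ne_bot hr hs) (inf_le_inf_right s hru)
  · exact h u hu (sdiff_eq_bot_iff.mp (sdiff_eq.trans h0))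

end BCA

theorem stmt_6 {B : Type*} [BooleanAlgebra B] (A : BCA B)
    (hat : BCA.Atomless B) (hdv7 : A.DV7) (Q : Set B) (hQ : A.IsGRep Q) :
    A.IsWRep Q := by
  exact ⟨hQ.isAbstractive hat hdv7, fun _ hT hQT => hQ.covers_of_covers hT hQT⟩
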